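/- If m, n ≥ 3 are integers with |m − n| = 1, then the treewidth of the toroidal grid graph T_{m,n} satisfies 2·min{m, n} − 1 ≤ tw(T_{m,n}) ≤ 2·min{m, n}. -/

import Mathlib

open SimpleGraph

/-- A tree decomposition of a graph `G`: a tree `tree` on node type `ι` with a bag of
vertices of `G` at each node, such that every vertex lies in some bag, both endpoints of
every edge lie in a common bag, and for each vertex the set of nodes whose bags contain it
induces a connected subgraph of the tree. -/
structure TreeDecomp {V : Type*} (G : SimpleGraph V) where
  ι : Type
  tree : SimpleGraph ι
  isTree : tree.IsTree
  bag : ι → Set V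
  bag_cover : ∀ v : V, ∃ t, v ∈ bag t
  bag_edge : ∀ ⦃u v : V⦄, G.Adj u v → ∃ t, u ∈ bag t ∧ v ∈ bag t
  bag_conn : ∀ v : V, (tree.induce {t | v ∈ bag t}).Connected

/-- The treewidth of `G`: the least `k` such that some tree decomposition of `G` has all
bags of size at most `k + 1` (i.e. the minimum over tree decompositions of one less than
the maximum bag size). -/
noncomputable def treewidth {V : Type*} (G : SimpleGraph V) : ℕ :=
  sInf {k : ℕ | ∃ D : TreeDecomp G, ∀ t, (D.bag t).ncard ≤ k + 1}

/-- Two vertex sets touch if their union induces a connected subgraph. -/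
def Touches {V : Type*} (G : SimpleGraph V) (A B : Set V) : Prop :=
  (G.induce (A ∪ B)).Connected

/-- A bramble: a family of vertex sets, each inducing a connected subgraph,
that pairwise touch. -/
structure IsBramble {V : Type*} (G : SimpleGraph V) (ℬ : Set (Set V)) : Prop where
  conn : ∀ B ∈ ℬ, (G.induce B).Connected
  touch : ∀ A ∈ ℬ, ∀ B ∈ ℬ, Touches G A B

/-- A strict bramble: a bramble any two of whose members share a vertex. -/
def IsStrictBramble {V : Type*} (G : SimpleGraph V) (ℬ : Set (Set V)) : Prop :=
  IsBramble G ℬ ∧ ∀ A ∈ ℬ, ∀ B ∈ ℬ, (A ∩ B).Nonempty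

/-- A hitting set for a family of vertex sets: a set meeting every member. -/
def IsHittingSet {V : Type*} (ℬ : Set (Set V)) (S : Set V) : Prop :=
  ∀ B ∈ ℬ, (S ∩ B).Nonempty

/-- The order of a bramble: the minimum size of a hitting set. -/
noncomputable def brambleOrder {V : Type*} (ℬ : Set (Set V)) : ℕ :=
  sInf {k : ℕ | ∃ S : Set V, IsHittingSet ℬ S ∧ S.ncard = k}

/-- The bramble number of `G`: the maximum order of a bramble on `G`. -/
noncomputable def brambleNumber {V : Type*} (G : SimpleGraph V) : ℕ :=
  sSup {k : ℕ | ∃ ℬ, IsBramble G ℬ ∧ brambleOrder ℬ = k}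

/-- The strict bramble number of `G`: the maximum order of a strict bramble on `G`. -/
noncomputable def strictBrambleNumber {V : Type*} (G : SimpleGraph V) : ℕ :=
  sSup {k : ℕ | ∃ ℬ, IsStrictBramble G ℬ ∧ brambleOrder ℬ = k}

/-- The `m × n` grid graph `P_m □ P_n`. -/
def gridGraph (m n : ℕ) : SimpleGraph (Fin m × Fin n) :=
  SimpleGraph.pathGraph m □ SimpleGraph.pathGraph n

/-- The stacked prism graph `Y_{m,n} = C_m □ P_n`. -/
def stackedPrism (m n : ℕ) : SimpleGraph (Fin m × Fin n) :=
  SimpleGraph.cycleGraph m □ SimpleGraph.pathGraph n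

/-- The toroidal grid graph `T_{m,n} = C_m □ C_n`. -/
def toroidalGrid (m n : ℕ) : SimpleGraph (Fin m × Fin n) :=
  SimpleGraph.cycleGraph m □ SimpleGraph.cycleGraph n

/-- `H` is a minor of `G`: there are pairwise disjoint nonempty connected branch sets in `G`,
one for each vertex of `H`, with an edge of `G` between the branch sets of any two vertices
adjacent in `H`. -/
def IsGraphMinor {W V : Type*} (H : SimpleGraph W) (G : SimpleGraph V) : Prop :=
  ∃ B : W → Set V,
    (∀ w, (B w).Nonempty) ∧
    (∀ w, (G.induce (B w)).Connected) ∧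
    (∀ w₁ w₂, w₁ ≠ w₂ → Disjoint (B w₁) (B w₂)) ∧
    (∀ ⦃w₁ w₂⦄, H.Adj w₁ w₂ → ∃ v₁ ∈ B w₁, ∃ v₂ ∈ B w₂, G.Adj v₁ v₂)

open Classical in
/-- The chip-firing move at a vertex `v`: `v` loses one chip along each incident edge,
each neighbor of `v` gains one chip. -/
noncomputable def fireVertex {V : Type*} (G : SimpleGraph V) (D : V → ℤ) (v : V) : V → ℤ :=
  fun u => if u = v then D u - (G.neighborSet v).ncard
    else if G.Adj v u then D u + 1 else D u

/-- Two divisors on `G` are equivalent if one is obtained from the other by a finite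
sequence of chip-firing moves. -/
def ChipEquiv {V : Type*} (G : SimpleGraph V) : (V → ℤ) → (V → ℤ) → Prop :=
  Relation.EqvGen (fun D D' => ∃ v, D' = fireVertex G D v)

/-- A divisor `D` wins the gonality game on `G` if for every vertex `q`, the divisor
`D - q` is equivalent to an effective divisor. -/
def WinsGonalityGame {V : Type*} [DecidableEq V] (G : SimpleGraph V) (D : V → ℤ) : Prop :=
  ∀ q : V, ∃ E : V → ℤ, (∀ v, 0 ≤ E v) ∧
    ChipEquiv G (fun v => D v - if v = q then 1 else 0) E

/-- The divisorial gonality of `G`: the least degree of an effective divisor winning the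
gonality game. -/
noncomputable def gonality {V : Type*} [Fintype V] [DecidableEq V] (G : SimpleGraph V) : ℕ :=
  sInf {k : ℕ | ∃ D : V → ℤ, (∀ v, 0 ≤ D v) ∧ (∑ v, D v) = (k : ℤ) ∧ WinsGonalityGame G D}

lemma SimpleGraph.IsTree.exists_gate {ι : Type*} {T : SimpleGraph ι} (hT : T.IsTree) (r : ι)
    {A : Set ι} (hA : (T.induce A).Connected) :
    ∃ a ∈ A, ∀ s ∈ A, ∀ P : T.Walk r s, P.IsPath →
      a ∈ P.support ∧ ∀ x ∈ P.support, T.dist r a ≤ T.dist r x → x ∈ A := by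
  classical
  have hne : A.Nonempty := Set.nonempty_coe_sort.mp hA.nonempty
  let a := Function.argminOn (T.dist r) A hne
  have haA : a ∈ A := Function.argminOn_mem _ _ _
  have hmin : ∀ x ∈ A, T.dist r a ≤ T.dist r x := fun x hx => Function.argminOn_le _ _ hx
  refine ⟨a, haA, fun s hs P hP => ?_⟩
  obtain ⟨p, hp, hpl⟩ := hT.1.exists_path_of_dist r a
  obtain ⟨q', hq'⟩ := (hA.preconnected ⟨a, haA⟩ ⟨s, hs⟩).exists_isPath
  let q : T.Walk a s := q'.map (Embedding.induce (G := T) A).toHom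
  have hq : q.IsPath := hq'.map (Embedding.induce (G := T) A).injective
  have hqA : ∀ x ∈ q.support, x ∈ A := by
    intro x hx
    have hx' : x ∈ (q'.map (Embedding.induce (G := T) A).toHom).support := hx
    rw [Walk.support_map, List.mem_map] at hx'
    obtain ⟨y, -, rfl⟩ := hx'
    exact y.2
  have hpa : ∀ x ∈ p.support, T.dist r a ≤ T.dist r x → x = a := by
    intro x hx hle
    by_contra hne
    have h1 := p.length_takeUntil_lt_length hx hne
    have h2 := dist_le (p.takeUntil x hx)
    omega
  have hpq : (p.append q).IsPath := by
    rw [Walk.isPath_def, Walk.support_append, List.nodup_append']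
    refine ⟨hp.support_nodup, hq.support_nodup.tail, fun x hxp hxq => ?_⟩
    have hxa := hpa x hxp (hmin x (hqA x (List.mem_of_mem_tail hxq)))
    have := hq.support_nodup
    rw [← Walk.cons_tail_support, List.nodup_cons] at this
    exact this.1 (hxa ▸ hxq)
  obtain rfl : P = p.append q := (hT.existsUnique_path r s).unique hP hpq
  refine ⟨by simp, fun x hx hle => ?_⟩
  rcases Walk.mem_support_append_iff _ _ |>.mp hx with h | h
  · exact hpa x h hle ▸ haA
  · exact hqA x h

/-- Helly property: finitely many pairwise intersecting subtrees of a tree share a node. -/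
lemma SimpleGraph.IsTree.exists_mem_of_pairwise_inter {ι κ : Type*} [Finite κ]
    {T : SimpleGraph ι} (hT : T.IsTree) (A : κ → Set ι)
    (hA : ∀ k, (T.induce (A k)).Connected) (hinter : ∀ k l, (A k ∩ A l).Nonempty) :
    ∃ t, ∀ k, t ∈ A k := by
  obtain ⟨r⟩ := hT.1.nonempty
  choose a ha hgate using fun k => hT.exists_gate r (hA k)
  cases isEmpty_or_nonempty κ
  · exact ⟨r, fun k => isEmptyElim k⟩
  obtain ⟨k, hk⟩ := Finite.exists_max fun k => T.dist r (a k)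
  refine ⟨a k, fun l => ?_⟩
  obtain ⟨s, hsk, hsl⟩ := hinter k l
  obtain ⟨P, hP⟩ := (hT.1.preconnected r s).exists_isPath
  exact (hgate l s hsl P hP).2 _ (hgate k s hsk P hP).1 (hk l)

lemma SimpleGraph.isAcyclic_hasse {α : Type*} [LinearOrder α] : (hasse α).IsAcyclic := by
  have key : ∀ u v : α, u ⋖ v → ¬ ((hasse α).deleteEdges {s(u, v)}).Reachable u v := by
    intro u v huv h
    have inv : ∀ x, ((hasse α).deleteEdges {s(u, v)}).Reachable u x → x ≤ u := by
      intro x hx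
      rw [reachable_iff_reflTransGen] at hx
      induction hx with
      | refl => rfl
      | @tail x y _ hxy ih =>
        rw [deleteEdges_adj, hasse_adj] at hxy
        obtain ⟨hxy | hxy, hne⟩ := hxy
        · by_contra hy
          obtain rfl := ih.antisymm (le_of_not_gt fun hlt => hy (hxy.ge_of_gt hlt))
          exact hne (by rw [hxy.unique_right huv]; rfl)
        · exact hxy.le.trans ih
    exact (inv v h).not_gt huv.lt
  rw [isAcyclic_iff_forall_adj_isBridge]
  intro u v huv
  rw [isBridge_iff]
  rcases huv with h | h
  · exact key u v h
  · exact fun h' => key v u h (by rw [Sym2.eq_swap]; exact h'.symm)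

lemma SimpleGraph.isTree_hasse_nat : (hasse ℕ).IsTree :=
  ⟨⟨hasse_preconnected_of_succ ℕ⟩, isAcyclic_hasse⟩

lemma SimpleGraph.connected_induce_hasse_nat {s : Set ℕ} (hs : s.OrdConnected)
    (hne : s.Nonempty) : ((hasse ℕ).induce s).Connected := by
  have key : ∀ a (ha : a ∈ s) b (hb : b ∈ s), a ≤ b →
      ((hasse ℕ).induce s).Reachable ⟨a, ha⟩ ⟨b, hb⟩ := by
    intro a ha b hb hab
    induction b, hab using Nat.le_induction with
    | base => exact .rfl
    | succ b hab ih =>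
      have hb' : b ∈ s := hs.out ha hb ⟨hab, b.le_succ⟩
      exact (ih hb').trans (Adj.reachable (by simp [hasse_adj]))
  rw [connected_iff]
  refine ⟨?_, hne.to_subtype⟩
  rintro ⟨a, ha⟩ ⟨b, hb⟩
  rcases le_total a b with h | h
  · exact key a ha b hb h
  · exact (key b hb a ha h).symm

lemma TreeDecomp.connected_induce_bag_inter {V : Type*} {G : SimpleGraph V} (D : TreeDecomp G)
    {B : Set V} (hB : (G.induce B).Connected) :
    (D.tree.induce {t | (D.bag t ∩ B).Nonempty}).Connected := by
  have key : ∀ (u : V) (hu : u ∈ B) (t : D.ι) (ht : u ∈ D.bag t) (v : B),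
      (G.induce B).Reachable ⟨u, hu⟩ v → ∀ (t' : D.ι) (ht' : v.1 ∈ D.bag t'),
      (D.tree.induce {t | (D.bag t ∩ B).Nonempty}).Reachable
        ⟨t, u, ht, hu⟩ ⟨t', v.1, ht', v.2⟩ := by
    have local_reach : ∀ (v : V) (hv : v ∈ B) (t t' : D.ι) (ht : v ∈ D.bag t)
        (ht' : v ∈ D.bag t'), (D.tree.induce {t | (D.bag t ∩ B).Nonempty}).Reachable
        ⟨t, v, ht, hv⟩ ⟨t', v, ht', hv⟩ := fun v hv t t' ht ht' =>
      ((D.bag_conn v).preconnected ⟨t, ht⟩ ⟨t', ht'⟩).map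
        (induceHomOfLE D.tree (s := {t | v ∈ D.bag t})
          (s' := {t | (D.bag t ∩ B).Nonempty}) fun t ht => ⟨v, ht, hv⟩).toHom
    intro u hu t ht v huv
    rw [reachable_iff_reflTransGen] at huv
    induction huv with
    | refl => exact fun t' ht' => local_reach u hu t t' ht ht'
    | @tail v w _ hvw ih =>
      intro t' ht'
      obtain ⟨s, hvs, hws⟩ := D.bag_edge (show G.Adj v.1 w.1 from hvw)
      exact (ih s hvs).trans (local_reach w.1 w.2 s t' hws ht')
  obtain ⟨v⟩ := hB.nonempty
  obtain ⟨t, ht⟩ := D.bag_cover v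
  rw [connected_iff]
  refine ⟨?_, ⟨t, v, ht, v.2⟩⟩
  rintro ⟨t, u, ht, hu⟩ ⟨s, v, hs, hv⟩
  exact key u hu t ht ⟨v, hv⟩ (hB.preconnected _ _) s hs

/-- Some bag of a tree decomposition of a finite graph meets every member of a given family of
connected, pairwise touching vertex sets. -/
lemma TreeDecomp.exists_bag_inter_nonempty {V : Type*} [Finite V] {G : SimpleGraph V}
    (D : TreeDecomp G) (F : Set (Set V)) (hconn : ∀ B ∈ F, (G.induce B).Connected)
    (htouch : ∀ A ∈ F, ∀ B ∈ F, ∃ u ∈ A, ∃ v ∈ B, u = v ∨ G.Adj u v) :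
    ∃ t, ∀ B ∈ F, (D.bag t ∩ B).Nonempty := by
  obtain ⟨t, ht⟩ := D.isTree.exists_mem_of_pairwise_inter
    (fun B : F => {t | (D.bag t ∩ B.1).Nonempty})
    (fun B => D.connected_induce_bag_inter (hconn B.1 B.2)) (by
      rintro ⟨A, hA⟩ ⟨B, hB⟩
      obtain ⟨u, hu, v, hv, rfl | huv⟩ := htouch A hA B hB
      · obtain ⟨t, ht⟩ := D.bag_cover u
        exact ⟨t, ⟨u, ht, hu⟩, ⟨u, ht, hv⟩⟩
      · obtain ⟨t, hut, hvt⟩ := D.bag_edge huv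
        exact ⟨t, ⟨u, hut, hu⟩, ⟨v, hvt, hv⟩⟩)
  exact ⟨t, fun B hB => ht ⟨B, hB⟩⟩

/-- Transport of a tree decomposition along a graph isomorphism. -/
def TreeDecomp.mapIso {V W : Type*} {G : SimpleGraph V} {H : SimpleGraph W} (D : TreeDecomp G)
    (e : G ≃g H) : TreeDecomp H where
  ι := D.ι
  tree := D.tree
  isTree := D.isTree
  bag t := e.symm ⁻¹' D.bag t
  bag_cover v := D.bag_cover (e.symm v)
  bag_edge _ _ h := D.bag_edge (e.symm.map_rel_iff.mpr h)
  bag_conn v := D.bag_conn (e.symm v)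

lemma TreeDecomp.ncard_bag_mapIso {V W : Type*} {G : SimpleGraph V} {H : SimpleGraph W}
    (D : TreeDecomp G) (e : G ≃g H) (t : D.ι) :
    ((D.mapIso e).bag t).ncard = (D.bag t).ncard :=
  Set.ncard_preimage_of_injective_subset_range e.symm.injective fun x _ => e.symm.surjective x

lemma treewidth_congr {V W : Type*} {G : SimpleGraph V} {H : SimpleGraph W} (e : G ≃g H) :
    treewidth G = treewidth H := by
  unfold treewidth
  congr 1
  ext k
  constructor
  · rintro ⟨D, hD⟩
    exact ⟨D.mapIso e, fun t => (D.ncard_bag_mapIso e t).trans_le (hD t)⟩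
  · rintro ⟨D, hD⟩
    exact ⟨D.mapIso e.symm, fun t => (D.ncard_bag_mapIso e.symm t).trans_le (hD t)⟩

lemma cycleGraph_adj_val {n : ℕ} {u v : Fin n} (h : (cycleGraph n).Adj u v) :
    u.val + 1 = v.val ∨ v.val + 1 = u.val ∨ u.val = 0 ∨ v.val = 0 := by
  have hsub : ∀ a b : Fin n, (a - b).val = 1 → a.val = 0 ∨ b.val + 1 = a.val := by
    intro a b hab
    rcases le_or_gt b a with hle | hlt
    · rw [Fin.sub_val_of_le hle] at hab
      omega
    · rw [Fin.coe_sub_iff_lt.mpr hlt] at hab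
      omega
  rw [cycleGraph_adj'] at h
  rcases h with h | h
  · rcases hsub _ _ h with h | h <;> omega
  · rcases hsub _ _ h with h | h <;> omega

/-- Sweeping along `C_n` while keeping the first cycle in every bag gives a path decomposition
of the torus of width at most `2 * m`. -/
lemma exists_treeDecomp_toroidalGrid (m n : ℕ) :
    ∃ D : TreeDecomp (toroidalGrid m n), ∀ t, (D.bag t).ncard ≤ 2 * m + 1 := by
  let idx : Fin m × Fin n → ℕ := fun v => v.2.val * m + v.1.val
  let sweep : ℕ → Set (Fin m × Fin n) := fun t => {v | v.2.val = 0 ∨ t ≤ idx v ∧ idx v ≤ t + m}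
  have edge_le : ∀ u v : Fin m × Fin n, idx u ≤ idx v → idx v ≤ idx u + m →
      ∃ t, u ∈ sweep t ∧ v ∈ sweep t := fun u v h₁ h₂ =>
    ⟨idx u, .inr ⟨le_rfl, by omega⟩, .inr ⟨h₁, h₂⟩⟩
  have edge : ∀ u v : Fin m × Fin n, idx u ≤ idx v + m → idx v ≤ idx u + m →
      ∃ t, u ∈ sweep t ∧ v ∈ sweep t := fun u v h₁ h₂ => by
    rcases le_total (idx u) (idx v) with h | h
    · exact edge_le u v h h₂
    · obtain ⟨t, hv, hu⟩ := edge_le v u h h₁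
      exact ⟨t, hu, hv⟩
  have idx_inj : Function.Injective idx := by
    rintro ⟨i, j⟩ ⟨i', j'⟩ h
    have h₁ : (j.val * m + i.val) / m = (j'.val * m + i'.val) / m := congrArg (· / m) h
    have h₂ : (j.val * m + i.val) % m = (j'.val * m + i'.val) % m := congrArg (· % m) h
    have hpos : 0 < m := i.pos
    rw [mul_comm, mul_comm j'.val, Nat.mul_add_div hpos, Nat.mul_add_div hpos,
      Nat.div_eq_of_lt i.2, Nat.div_eq_of_lt i'.2] at h₁
    rw [mul_comm, mul_comm j'.val, Nat.mul_add_mod, Nat.mul_add_mod,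
      Nat.mod_eq_of_lt i.2, Nat.mod_eq_of_lt i'.2] at h₂
    exact Prod.ext (Fin.ext h₂) (Fin.ext (by simpa using h₁))
  refine ⟨{
    ι := ℕ
    tree := hasse ℕ
    isTree := isTree_hasse_nat
    bag := sweep
    bag_cover := fun v => ⟨idx v, .inr ⟨le_rfl, by omega⟩⟩
    bag_edge := ?_
    bag_conn := ?_ }, ?_⟩
  · rintro u v (⟨-, h⟩ | ⟨h, h'⟩)
    · have h₁ := u.1.2
      have h₂ := v.1.2
      have h₃ : u.2.val * m = v.2.val * m := by rw [h]
      exact edge u v (by simp only [idx]; omega) (by simp only [idx]; omega)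
    · have h₁ : u.1.val = v.1.val := by rw [h']
      rcases cycleGraph_adj_val h with h | h | h | h
      · have h₃ : v.2.val * m = u.2.val * m + m := by rw [← h]; ring
        exact edge u v (by simp only [idx]; omega) (by simp only [idx]; omega)
      · have h₃ : u.2.val * m = v.2.val * m + m := by rw [← h]; ring
        exact edge u v (by simp only [idx]; omega) (by simp only [idx]; omega)
      · exact ⟨idx v, .inl h, .inr ⟨le_rfl, by omega⟩⟩
      · exact ⟨idx u, .inr ⟨le_rfl, by omega⟩, .inl h⟩
  · intro v
    refine connected_induce_hasse_nat ⟨?_⟩ ⟨idx v, .inr ⟨le_rfl, by omega⟩⟩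
    rintro a (ha | ha) b (hb | hb) c ⟨hac, hcb⟩
    · exact .inl ha
    · exact .inl ha
    · exact .inl hb
    · exact .inr ⟨by omega, by omega⟩
  · intro t
    have h₁ : {v : Fin m × Fin n | v.2.val = 0}.ncard ≤ m := by
      refine (Set.ncard_le_ncard_of_injOn Prod.fst (t := Set.univ) (fun _ _ => trivial) ?_).trans
        (by simp)
      rintro ⟨i, j⟩ hj ⟨i', j'⟩ hj' rfl
      exact Prod.ext rfl (Fin.ext (hj.trans hj'.symm))
    have h₂ : {v | t ≤ idx v ∧ idx v ≤ t + m}.ncard ≤ m + 1 := by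
      refine (Set.ncard_le_ncard_of_injOn idx (t := (Finset.Icc t (t + m) : Set ℕ))
        (fun v hv => by simpa using hv) idx_inj.injOn).trans ?_
      rw [Set.ncard_coe_finset, Nat.card_Icc]
      omega
    have := Set.ncard_union_le {v : Fin m × Fin n | v.2.val = 0}
      {v | t ≤ idx v ∧ idx v ≤ t + m}
    change ({v : Fin m × Fin n | v.2.val = 0} ∪ {v | t ≤ idx v ∧ idx v ≤ t + m}).ncard ≤ _
    omega

lemma treewidth_toroidalGrid_le (m n : ℕ) : treewidth (toroidalGrid m n) ≤ 2 * m :=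
  Nat.sInf_le (exists_treeDecomp_toroidalGrid m n)

lemma cycleGraph_connected_induce_compl {n : ℕ} {s : Set (Fin (n + 2))} (hs : s.Subsingleton) :
    ((cycleGraph (n + 2)).induce sᶜ).Connected := by
  rcases hs.eq_empty_or_singleton with rfl | ⟨y, rfl⟩
  · rw [Set.compl_empty]
    exact (induceUnivIso _).connected_iff.mpr cycleGraph_connected
  · have hy : y + 1 ∈ ({y} : Set (Fin (n + 2)))ᶜ := by simp
    have key : ∀ (d : ℕ) (x : Fin (n + 2)) (hx : x ∈ ({y} : Set (Fin (n + 2)))ᶜ),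
        (x - y).val = d + 1 →
        ((cycleGraph (n + 2)).induce {y}ᶜ).Reachable ⟨y + 1, hy⟩ ⟨x, hx⟩ := by
      intro d
      induction d with
      | zero =>
        intro x hx hd
        obtain rfl : x = y + 1 := by
          rw [← sub_eq_iff_eq_add']
          exact Fin.ext (by simpa using hd)
        exact .rfl
      | succ d ih =>
        intro x hx hd
        have hne : x - y ≠ 0 := fun h => by simp [h] at hd
        have hval : (x - 1 - y).val = d + 1 := by
          rw [sub_right_comm, Fin.val_sub_one_of_ne_zero hne]
          omega
        have hx' : x - 1 ∈ ({y} : Set (Fin (n + 2)))ᶜ := by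
          rintro rfl
          simp at hval
        refine (ih _ hx' hval).trans (Adj.reachable ?_)
        simp [cycleGraph_adj]
    rw [connected_iff_exists_forall_reachable]
    refine ⟨⟨y + 1, hy⟩, fun ⟨x, hx⟩ => key ((x - y).val - 1) x hx ?_⟩
    have : (x - y).val ≠ 0 := fun h => hx (sub_eq_zero.mp (Fin.ext h))
    omega

lemma SimpleGraph.connected_induce_cross {α β : Type*} {G : SimpleGraph α} {H : SimpleGraph β}
    {s : Set (α × β)} {i : α} {J : Set β} (hH : (H.induce {j | (i, j) ∈ s}).Connected)
    (hJ : ∀ j ∈ J, (i, j) ∈ s ∧ (G.induce {i' | (i', j) ∈ s}).Preconnected) :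
    ((G □ H).induce {v | v ∈ s ∧ (v.1 = i ∨ v.2 ∈ J)}).Connected := by
  obtain ⟨⟨j₀, hj₀⟩⟩ := hH.nonempty
  have col : ∀ j (hj : (i, j) ∈ s), ((G □ H).induce {v | v ∈ s ∧ (v.1 = i ∨ v.2 ∈ J)}).Reachable
      ⟨(i, j₀), hj₀, .inl rfl⟩ ⟨(i, j), hj, .inl rfl⟩ := fun j hj =>
    (hH.preconnected ⟨j₀, hj₀⟩ ⟨j, hj⟩).map
      ({ toFun := fun j => ⟨(i, j.1), j.2, .inl rfl⟩
         map_rel' := fun h => .inr ⟨h, rfl⟩ } :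
        H.induce {j | (i, j) ∈ s} →g (G □ H).induce {v | v ∈ s ∧ (v.1 = i ∨ v.2 ∈ J)})
  rw [connected_iff_exists_forall_reachable]
  refine ⟨⟨(i, j₀), hj₀, .inl rfl⟩, ?_⟩
  rintro ⟨⟨i', j⟩, hv, rfl | hj⟩
  · exact col j hv
  · obtain ⟨hij, hG⟩ := hJ j hj
    exact (col j hij).trans <| (hG ⟨i, hij⟩ ⟨i', hv⟩).map
      ({ toFun := fun i' => ⟨(i'.1, j), i'.2, .inr hj⟩
         map_rel' := fun h => .inl ⟨h, rfl⟩ } :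
        G.induce {i' | (i', j) ∈ s} →g (G □ H).induce {v | v ∈ s ∧ (v.1 = i ∨ v.2 ∈ J)})

/-- Fewer than `2 * m` points of an array with more rows than columns leave a column with at most
one point and either an empty row or two rows with at most one point, whose crossings with the
column are not among the points. -/
lemma exists_sparse_column_and_rows {m n : ℕ} (hmn : m < n) {s : Set (Fin m × Fin n)}
    (hs : s.ncard < 2 * m) :
    ∃ i, {j | (i, j) ∈ s}.Subsingleton ∧ ((∃ j, ∀ i', (i', j) ∉ s) ∨ ∃ j₁ j₂, j₁ ≠ j₂ ∧
      ∀ j, j = j₁ ∨ j = j₂ → {i' | (i', j) ∈ s}.Subsingleton ∧ (i, j) ∉ s) := by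
  classical
  obtain ⟨S, rfl⟩ := s.toFinite.exists_finset_coe
  rw [Set.ncard_coe_finset] at hs
  simp only [Finset.mem_coe]
  obtain ⟨i, -, hi⟩ := Finset.exists_card_fiber_lt_of_card_lt_mul (s := S)
    (t := (Finset.univ : Finset (Fin m))) (f := Prod.fst) (n := 2) (by simpa [mul_comm] using hs)
  have hcol : ∀ j j', (i, j) ∈ S → (i, j') ∈ S → j = j' := fun j j' hj hj' =>
    congrArg Prod.snd (Finset.card_le_one.mp (Nat.lt_succ_iff.mp hi) (i, j) (by simpa using hj)
      (i, j') (by simpa using hj'))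
  refine ⟨i, fun j hj j' hj' => hcol j j' hj hj', ?_⟩
  by_cases hrow : ∃ j, ∀ i', (i', j) ∉ S
  · exact .inl hrow
  right
  push Not at hrow
  let c : Fin n → ℕ := fun j => {v ∈ S | v.2 = j}.card
  have hc : ∀ j, 1 ≤ c j := by
    intro j
    obtain ⟨i', hi'⟩ := hrow j
    exact Finset.card_pos.mpr ⟨(i', j), by simpa using hi'⟩
  let A : Finset (Fin n) := {j | c j = 1}
  have hA : 2 < A.card := by
    have hsum : S.card = ∑ j, c j := Finset.card_eq_sum_card_fiberwise (by simp)
    have hle : ∑ _j : Fin n, 2 ≤ ∑ j, (c j + if c j = 1 then 1 else 0) :=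
      Finset.sum_le_sum fun j _ => by
        have := hc j
        split_ifs <;> omega
    rw [Finset.sum_add_distrib, ← Finset.card_filter, ← hsum] at hle
    simp only [Finset.sum_const, Finset.card_univ, Fintype.card_fin, smul_eq_mul] at hle
    change _ ≤ _ + A.card at hle
    omega
  have hB : ({j | (i, j) ∈ S} : Finset (Fin n)).card ≤ 1 :=
    Finset.card_le_one.mpr fun j hj j' hj' => hcol j j' (by simpa using hj) (by simpa using hj')
  have hAB := Finset.le_card_sdiff ({j | (i, j) ∈ S} : Finset (Fin n)) A
  obtain ⟨j₁, h₁, j₂, h₂, hne⟩ :=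
    Finset.one_lt_card.mp (show 1 < (A \ ({j | (i, j) ∈ S} : Finset (Fin n))).card by omega)
  have good : ∀ j ∈ A \ ({j | (i, j) ∈ S} : Finset (Fin n)),
      {i' | (i', j) ∈ S}.Subsingleton ∧ (i, j) ∉ S := by
    intro j hj
    simp only [Finset.mem_sdiff, A, Finset.mem_filter, Finset.mem_univ, true_and] at hj
    refine ⟨fun i₁ hi₁ i₂ hi₂ => ?_, hj.2⟩
    exact congrArg Prod.fst (Finset.card_le_one.mp hj.1.le (i₁, j) (by simpa using hi₁)
      (i₂, j) (by simpa using hi₂))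
  refine ⟨j₁, j₂, hne, ?_⟩
  rintro j (rfl | rfl)
  · exact good _ h₁
  · exact good _ h₂

/-- The connected vertex sets that contain a column of the torus up to one vertex and touch every
column minus a vertex. -/
def toroidalBramble (m n : ℕ) : Set (Set (Fin m × Fin n)) :=
  {X | ((toroidalGrid m n).induce X).Connected ∧ (∃ i y, ∀ j ≠ y, (i, j) ∈ X) ∧
    ∀ i y, ∃ j ≠ y, ∃ u ∈ X, u = (i, j) ∨ (toroidalGrid m n).Adj u (i, j)}

lemma exists_mem_toroidalBramble_disjoint {m n : ℕ} (hm : 2 ≤ m) (hmn : m < n)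
    {s : Set (Fin m × Fin n)} (hs : s.ncard < 2 * m) :
    ∃ X ∈ toroidalBramble m n, Disjoint s X := by
  obtain ⟨i, hi, hrows⟩ := exists_sparse_column_and_rows hmn hs
  obtain ⟨m, rfl⟩ := Nat.exists_eq_add_of_le' hm
  obtain ⟨n, rfl⟩ := Nat.exists_eq_add_of_le' (hm.trans hmn.le)
  let J : Set (Fin (n + 2)) := {j | {i' | (i', j) ∈ s}.Subsingleton ∧ (i, j) ∉ s}
  refine ⟨{v | v ∈ sᶜ ∧ (v.1 = i ∨ v.2 ∈ J)}, ⟨?_, ?_, ?_⟩,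
    Set.disjoint_left.mpr fun v hv hvX => hvX.1 hv⟩
  · exact connected_induce_cross (cycleGraph_connected_induce_compl hi)
      fun j hj => ⟨hj.2, (cycleGraph_connected_induce_compl hj.1).preconnected⟩
  · rcases hi.eq_empty_or_singleton with h | ⟨y, hy⟩
    · refine ⟨i, 0, fun j _ => ⟨fun hj => ?_, .inl rfl⟩⟩
      exact (h ▸ hj : j ∈ (∅ : Set _))
    · refine ⟨i, y, fun j hjy => ⟨fun hj => hjy ?_, .inl rfl⟩⟩
      exact (hy ▸ hj : j ∈ ({y} : Set _))
  · intro i' y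
    rcases hrows with ⟨j, hj⟩ | ⟨j₁, j₂, hne, hj⟩
    · have hmem : ∀ i', (i', j) ∈ {v | v ∈ sᶜ ∧ (v.1 = i ∨ v.2 ∈ J)} := fun i' =>
        ⟨hj i', .inr ⟨fun i₁ h₁ => (hj i₁ h₁).elim, hj i⟩⟩
      by_cases hjy : j = y
      · exact ⟨j + 1, by simp [hjy], (i', j), hmem i',
          .inr (boxProd_adj_right.mpr (by simp [cycleGraph_adj]))⟩
      · exact ⟨j, hjy, (i', j), hmem i', .inl rfl⟩
    · obtain ⟨j, hjy, hjJ⟩ : ∃ j ≠ y, j ∈ J := by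
        by_cases h : j₁ = y
        · exact ⟨j₂, fun h' => hne (h.trans h'.symm), hj j₂ (.inr rfl)⟩
        · exact ⟨j₁, h, hj j₁ (.inl rfl)⟩
      by_cases hmem : (i', j) ∈ s
      · refine ⟨j, hjy, (i' + 1, j), ⟨fun h => ?_, .inr hjJ⟩,
          .inr (boxProd_adj_left.mpr (by simp [cycleGraph_adj]))⟩
        have := hjJ.1 h hmem
        simp at this
      · exact ⟨j, hjy, (i', j), ⟨hmem, .inr hjJ⟩, .inl rfl⟩

lemma le_treewidth_toroidalGrid {m n : ℕ} (hm : 2 ≤ m) (hmn : m < n) :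
    2 * m - 1 ≤ treewidth (toroidalGrid m n) := by
  refine le_csInf ⟨_, exists_treeDecomp_toroidalGrid m n⟩ fun k ⟨D, hD⟩ => ?_
  by_contra! hk
  obtain ⟨t, ht⟩ := D.exists_bag_inter_nonempty (toroidalBramble m n) (fun X hX => hX.1) (by
    rintro X ⟨-, -, hX⟩ Y ⟨-, ⟨i, y, hY⟩, -⟩
    obtain ⟨j, hj, u, hu, huj⟩ := hX i y
    exact ⟨u, hu, (i, j), hY j hj, huj⟩)
  have hcard := hD t
  obtain ⟨X, hX, hdisj⟩ := exists_mem_toroidalBramble_disjoint hm hmn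
    (s := D.bag t) (by omega)
  exact (ht X hX).ne_empty hdisj.inter_eq

/-- If `m, n ≥ 3` and `|m − n| = 1`, the treewidth of the toroidal grid `T_{m,n}` satisfies
`2 · min {m, n} − 1 ≤ tw(T_{m,n}) ≤ 2 · min {m, n}`. -/
theorem toroidalGrid_treewidth_almost_square (m n : ℕ) (hm : 3 ≤ m) (hn : 3 ≤ n)
    (hmn : ((m : ℤ) - (n : ℤ)).natAbs = 1) :
    2 * min m n - 1 ≤ treewidth (toroidalGrid m n) ∧
      treewidth (toroidalGrid m n) ≤ 2 * min m n := by
  rcases Nat.lt_or_ge m n with h | h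
  · rw [min_eq_left h.le]
    exact ⟨le_treewidth_toroidalGrid (by omega) h, treewidth_toroidalGrid_le m n⟩
  · have e : toroidalGrid m n ≃g toroidalGrid n m := boxProdComm _ _
    rw [min_eq_right h, treewidth_congr e]
    exact ⟨le_treewidth_toroidalGrid (by omega) (by omega), treewidth_toroidalGrid_le n m⟩
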